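/- Let ν and a be real with a > 0. Set κ = 1 + a, h = a^{−a}, A₀ = (κ/a)^{ν+1}/√(2π), and for real x > 0 set Z(x) = κ (h x²/4)^{1/κ}. Then, as x → +∞ through positive real values, (x/2)^{−ν−1} L_ν(x; a) · Z(x)^{ν+3/2} · e^{−Z(x)} → A₀. In particular L_ν(x;a) is exponentially large as x → +∞. -/

import Mathlib

open Filter Topology

/-- The generalised Struve function
`L_ν(z;a) = (z/2)^{ν+1} Σ_{n≥0} (z/2)^{2n} / (Γ(n+3/2) Γ(an+ν+3/2))`,
with principal branch power and the entire reciprocal Gamma function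
(`Complex.Gamma` vanishes at the poles, so division realises `1/Γ`). -/
noncomputable def struveL (ν a : ℝ) (z : ℂ) : ℂ :=
  (z / 2) ^ ((ν : ℂ) + 1) *
    ∑' n : ℕ, (z / 2) ^ (2 * n) /
      (Complex.Gamma ((n : ℂ) + 3 / 2) *
        Complex.Gamma ((a : ℂ) * (n : ℂ) + (ν : ℂ) + 3 / 2))

/-- The variable `Z = κ (h x²/4)^{1/κ}` with `κ = 1 + a`, `h = a^{−a}`. -/
noncomputable def struveZ (a x : ℝ) : ℝ :=
  (1 + a) * (a ^ (-a) * x ^ 2 / 4) ^ (1 / (1 + a))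


lemma gamma_log_stirling_nat :
    Tendsto (fun n : ℕ => Real.log (Real.Gamma n) - (((n:ℝ) - 1/2) * Real.log n - n)) atTop
      (𝓝 (Real.log (2 * Real.pi) / 2)) := by
  have h := (Stirling.tendsto_stirlingSeq_sqrt_pi).log (by positivity)
  have h2 := h.add_const (Real.log 2 / 2)
  have e : Real.log (√Real.pi) + Real.log 2 / 2 = Real.log (2 * Real.pi) / 2 := by
    rw [Real.log_sqrt Real.pi_pos.le, Real.log_mul (by norm_num) Real.pi_pos.ne']; ring
  rw [e] at h2
  refine h2.congr' ?_
  filter_upwards [eventually_ge_atTop 1] with n hn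
  have hn' : (0:ℝ) < n := by exact_mod_cast hn
  rw [Stirling.log_stirlingSeq_formula]
  have hG : ((n.factorial : ℕ) : ℝ) = n * Real.Gamma n := by
    rw [← Real.Gamma_nat_eq_factorial, Real.Gamma_add_one hn'.ne']
  rw [hG, Real.log_mul hn'.ne' (Real.Gamma_pos_of_pos hn').ne', Real.log_mul (by norm_num) hn'.ne',
    Real.log_div hn'.ne' (Real.exp_pos _).ne', Real.log_exp]
  ring

lemma gamma_log_stirling :
    Tendsto (fun x : ℝ => Real.log (Real.Gamma x) - ((x - 1/2) * Real.log x - x)) atTop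
      (𝓝 (Real.log (2 * Real.pi) / 2)) := by
  have hn : Tendsto (fun x : ℝ => ⌈x⌉₊ - 1) atTop atTop :=
    (tendsto_sub_atTop_nat 1).comp tendsto_nat_ceil_atTop
  have hE := gamma_log_stirling_nat.comp hn
  have h1 : Tendsto (fun x : ℝ => 1 / (2 * x)) atTop (𝓝 0) := by
    have := tendsto_inv_atTop_zero.comp (tendsto_id.const_mul_atTop (show (0:ℝ) < 2 by norm_num))
    simpa [Function.comp_def] using this
  have h2 : Tendsto (fun x : ℝ => 2 / (x - 2)) atTop (𝓝 0) :=
    (tendsto_atTop_add_const_right _ (-2) tendsto_id).const_div_atTop 2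
  have hl := hE.sub h2
  have hu := hE.add h1
  rw [sub_zero] at hl
  rw [add_zero] at hu
  refine tendsto_of_tendsto_of_tendsto_of_le_of_le' hl hu ?_ ?_
  all_goals
    filter_upwards [eventually_gt_atTop 10] with x hx
    simp only [Function.comp]
    set n := ⌈x⌉₊ - 1 with hndef
    have hc1 : x ≤ ⌈x⌉₊ := Nat.le_ceil x
    have hc2 : (⌈x⌉₊ : ℝ) < x + 1 := Nat.ceil_lt_add_one (by linarith)
    have hc3 : 1 ≤ ⌈x⌉₊ := Nat.one_le_ceil_iff.2 (by linarith)
    have hnc : (n : ℝ) = ⌈x⌉₊ - 1 := by rw [hndef]; push_cast [hc3]; ring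
    have hn1 : x ≤ n + 1 := by linarith
    have hn2 : (n:ℝ) < x := by linarith
    have hn0 : (0:ℝ) < n := by linarith
    have hn3 : 2 ≤ n := by
      have : (2:ℝ) ≤ n := by linarith
      exact_mod_cast this
    obtain ⟨s, hs⟩ : ∃ s, s = x - n := ⟨_, rfl⟩
    have hs0 : 0 < s := by linarith
    have hs1 : s ≤ 1 := by linarith
    have hx0 : 0 < x := by linarith
    have hfeq : ∀ {y : ℝ}, 0 < y → (Real.log ∘ Real.Gamma) (y + 1) = (Real.log ∘ Real.Gamma) y + Real.log y := by
      intro y hy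
      simp only [Function.comp]
      rw [Real.Gamma_add_one hy.ne', Real.log_mul hy.ne' (Real.Gamma_pos_of_pos hy).ne', add_comm]
    have hxs : x = n + s := by linarith
  · have hlow := Real.BohrMollerup.f_add_nat_ge Real.convexOn_log_Gamma hfeq hn3 hs0
    simp only [Function.comp] at hlow
    rw [← hxs] at hlow
    have l1 := Real.one_sub_inv_le_log_of_pos (show 0 < n / x by positivity)
    rw [Real.log_div hn0.ne' hx0.ne', inv_div] at l1
    have hm0 : (0:ℝ) < n - 1 := by linarith
    have l2 := Real.one_sub_inv_le_log_of_pos (show 0 < (n - 1) / (n:ℝ) by positivity)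
    rw [Real.log_div hm0.ne' hn0.ne', inv_div] at l2
    have k1 := mul_le_mul_of_nonneg_left l1 (show 0 ≤ x - 1/2 by linarith)
    have k2 := mul_le_mul_of_nonneg_left l2 hs0.le
    have k3 : 2 / ((n:ℝ) - 1) ≤ 2 / (x - 2) := by
      apply div_le_div_of_nonneg_left <;> linarith
    have k4 : -(2 / ((n:ℝ) - 1)) ≤ (x - 1/2) * (1 - x / n) + s + s * (1 - n / (n - 1)) := by
      have : (x - 1/2) * (1 - x / n) + s + s * (1 - n / (n - 1)) = - ((s - 1/2) * s / n) - s / (n-1) := by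
        rw [hxs]; field_simp; ring
      rw [this]
      have a1 : (s - 1/2) * s / n ≤ 1 / (n - 1) := by
        apply div_le_div₀ <;> nlinarith
      have a2 : s / ((n:ℝ) - 1) ≤ 1 / (n-1) := by
        apply div_le_div₀ <;> linarith
      have : 2 / ((n:ℝ) - 1) = 1 / (n - 1) + 1 / (n-1) := by ring
      linarith
    have e3 : ((n:ℝ) - 1/2) * Real.log n = (x - 1/2) * Real.log n - s * Real.log n := by
      rw [hxs]; ring
    have k1' : (x - 1/2) * (1 - x / n) ≤ (x - 1/2) * Real.log n - (x - 1/2) * Real.log x := by linarith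
    have k2' : s * (1 - n / (n - 1)) ≤ s * Real.log (n - 1) - s * Real.log n := by linarith
    linarith
  · have hup := Real.BohrMollerup.f_add_nat_le Real.convexOn_log_Gamma hfeq (show n ≠ 0 by omega) hs0 hs1
    simp only [Function.comp] at hup
    rw [← hxs] at hup
    have l1 := Real.log_le_sub_one_of_pos (show 0 < n / x by positivity)
    rw [Real.log_div hn0.ne' hx0.ne'] at l1
    have k1 := mul_le_mul_of_nonneg_left l1 (show 0 ≤ x - 1/2 by linarith)
    have e3 : ((n:ℝ) - 1/2) * Real.log n = (x - 1/2) * Real.log n - s * Real.log n := by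
      rw [hxs]; ring
    have k4 : (x - 1/2) * (n / x - 1) + s ≤ 1 / (2 * x) := by
      have : (x - 1/2) * (n / x - 1) + s = s / (2 * x) := by
        have : (n:ℝ) = x - s := by linarith
        rw [this]; field_simp; ring
      rw [this]
      gcongr
    linarith

lemma gamma_log_stirling_shift (b : ℝ) :
    Tendsto (fun x : ℝ => Real.log (Real.Gamma (x + b)) - ((x + b - 1/2) * Real.log x - x)) atTop
      (𝓝 (Real.log (2 * Real.pi) / 2)) := by
  have h := gamma_log_stirling.comp (tendsto_atTop_add_const_right atTop b tendsto_id)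
  have h1 := Real.tendsto_mul_log_one_add_div_atTop b
  have h2 : Tendsto (fun x : ℝ => Real.log (1 + b / x)) atTop (𝓝 0) := by
    have : Tendsto (fun x : ℝ => 1 + b / x) atTop (𝓝 (1 + 0)) :=
      (tendsto_id.const_div_atTop b).const_add 1
    have := this.log (by norm_num)
    simpa using this
  have h3 := (h.add (h1.sub_const b)).add (h2.const_mul (b - 1/2))
  simp only [sub_self, mul_zero, add_zero] at h3
  refine h3.congr' ?_
  filter_upwards [eventually_gt_atTop 0, eventually_gt_atTop (-b)] with x hx hxb
  have hxb' : 0 < x + b := by linarith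
  have : 1 + b / x = (x + b) / x := by field_simp
  rw [this, Real.log_div hxb'.ne' hx.ne']
  simp only [Function.comp, id]
  ring

lemma hasSum_of_integrable_floor (g : ℕ → ℝ) (h0 : g 0 = 0)
    (hi : MeasureTheory.Integrable (fun s : ℝ => g ⌊s⌋₊)) :
    HasSum g (∫ s : ℝ, g ⌊s⌋₊) := by
  have hd : Pairwise (Function.onFun Disjoint (fun i : ℕ => Set.Ico (i:ℝ) (i+1))) := by
    intro i j hij
    rw [Function.onFun, Set.disjoint_left]
    intro x hx hy
    apply hij
    have h1 := (Nat.floor_eq_iff (le_trans (Nat.cast_nonneg i) hx.1)).2 hx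
    have h2 := (Nat.floor_eq_iff (le_trans (Nat.cast_nonneg i) hx.1)).2 hy
    omega
  have h := MeasureTheory.hasSum_integral_iUnion (μ := MeasureTheory.volume)
    (f := fun s : ℝ => g ⌊s⌋₊) (s := fun i : ℕ => Set.Ico (i:ℝ) (i+1))
    (fun i => measurableSet_Ico) hd hi.integrableOn
  have e1 : ∀ i : ℕ, ∫ s in Set.Ico (i:ℝ) (i+1), g ⌊s⌋₊ = g i := by
    intro i
    rw [MeasureTheory.setIntegral_congr_fun (g := fun _ => g i) measurableSet_Ico]
    · simp
    · intro x hx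
      simp only
      rw [(Nat.floor_eq_iff (le_trans (Nat.cast_nonneg i) hx.1)).2 hx]
  simp only [e1] at h
  rwa [MeasureTheory.setIntegral_eq_integral_of_forall_compl_eq_zero] at h
  intro x hx
  have : x < 0 := by
    by_contra hc
    push Not at hc
    exact hx (Set.mem_iUnion.2 ⟨⌊x⌋₊, Nat.floor_le hc, Nat.lt_floor_add_one x⟩)
  rw [Nat.floor_of_nonpos this.le, h0]

lemma log_sqrt_bound {A B : ℝ} (hA : 1 ≤ A) (hB : 1 ≤ B) :
    Real.log A - Real.log B ≤ 2 * Real.log (1 + |√A - √B|) := by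
  have hsB : 1 ≤ √B := Real.one_le_sqrt.2 hB
  have hsA : 1 ≤ √A := Real.one_le_sqrt.2 hA
  have h1 : √A ≤ √B * (1 + |√A - √B|) := by
    nlinarith [le_abs_self (√A - √B), abs_nonneg (√A - √B)]
  have h2 := Real.log_le_log (by linarith) h1
  rw [Real.log_mul (by linarith) (by positivity), Real.log_sqrt (by linarith),
    Real.log_sqrt (by linarith)] at h2
  linarith

lemma psi_bound {A B : ℝ} (hA : 1 ≤ A) (hB : 1 ≤ B) :
    |√A - √B| ^ 2 ≤ B - A + A * (Real.log A - Real.log B) := by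
  have hsB : 1 ≤ √B := Real.one_le_sqrt.2 hB
  have hsA : 1 ≤ √A := Real.one_le_sqrt.2 hA
  have qA : √A ^ 2 = A := Real.sq_sqrt (by linarith)
  have qB : √B ^ 2 = B := Real.sq_sqrt (by linarith)
  have h := Real.one_sub_inv_le_log_of_pos (show 0 < √A / √B by positivity)
  rw [Real.log_div (by positivity) (by positivity), Real.log_sqrt (by linarith),
    Real.log_sqrt (by linarith), inv_div] at h
  have h2 := mul_le_mul_of_nonneg_left h (show 0 ≤ 2 * A by linarith)
  have h3 : 2 * A * (1 - √B / √A) = 2 * A - 2 * √A * √B := by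
    rw [← qA]; field_simp; simp; ring
  rw [sq_abs]
  nlinarith

lemma floor_dist_bound {N y : ℝ} (hN : 1 ≤ N) (hn : 1 ≤ ⌊N + √N * y⌋₊) :
    |y| ≤ (1 + |√(⌊N + √N * y⌋₊ : ℝ) - √N|) ^ 2 := by
  set n := ⌊N + √N * y⌋₊ with hndef
  have hn' : (1:ℝ) ≤ n := by exact_mod_cast hn
  have hpos : 0 ≤ N + √N * y := by
    by_contra hc
    push Not at hc
    rw [Nat.floor_of_nonpos hc.le] at hndef
    omega
  have f1 : (n:ℝ) ≤ N + √N * y := Nat.floor_le hpos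
  have f2 : N + √N * y < n + 1 := Nat.lt_floor_add_one _
  have hsN : 1 ≤ √N := Real.one_le_sqrt.2 hN
  have hsn : 1 ≤ √(n:ℝ) := Real.one_le_sqrt.2 hn'
  have qN : √N ^ 2 = N := Real.sq_sqrt (by linarith)
  have qn : √(n:ℝ) ^ 2 = n := Real.sq_sqrt (by linarith)
  set d := |√(n:ℝ) - √N| with hd
  have hd0 : 0 ≤ d := abs_nonneg _
  have habs : |(n:ℝ) - N| ≤ d * (2 * √N + d) := by
    have : (n:ℝ) - N = (√(n:ℝ) - √N) * (√(n:ℝ) + √N) := by nlinarith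
    rw [this, abs_mul, ← hd, abs_of_nonneg (show 0 ≤ √(n:ℝ) + √N by linarith)]
    apply mul_le_mul_of_nonneg_left _ hd0
    linarith [le_abs_self (√(n:ℝ) - √N)]
  have h1 : √N * |y| ≤ √N * (1 + d) ^ 2 := by
    have : √N * |y| = |√N * y| := by rw [abs_mul, abs_of_nonneg (by linarith : 0 ≤ √N)]
    rw [this]
    have : |√N * y| ≤ |(n:ℝ) - N| + 1 := by
      rw [abs_le]
      constructor
      · linarith [neg_abs_le ((n:ℝ) - N)]
      · linarith [le_abs_self ((n:ℝ) - N)]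
    nlinarith [mul_nonneg hd0 hd0, mul_nonneg (mul_nonneg hd0 hd0) (by linarith : 0 ≤ √N - 1)]
  exact le_of_mul_le_mul_left h1 (by linarith)

lemma exp_dom_bound (κ p : ℝ) (hκ : 0 < κ) : ∃ C : ℝ, 0 ≤ C ∧ ∀ N y : ℝ, 1 ≤ N →
    1 ≤ ⌊N + √N * y⌋₊ →
    Real.exp (-κ * (N - (⌊N + √N * y⌋₊ : ℝ) + (⌊N + √N * y⌋₊ : ℝ) *
      (Real.log (⌊N + √N * y⌋₊ : ℝ) - Real.log N)) +
      p * (Real.log (⌊N + √N * y⌋₊ : ℝ) - Real.log N)) ≤ C * (1 + y ^ 2)⁻¹ := by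
  set m := 2 * |p| + 4 with hm
  refine ⟨Real.exp (m ^ 2 / (4 * κ)) * 2, by positivity, ?_⟩
  intro N y hN hn
  have hy := floor_dist_bound hN hn
  set n := ⌊N + √N * y⌋₊ with hndef
  have hn' : (1:ℝ) ≤ n := by exact_mod_cast hn
  have b1 := psi_bound hn' hN
  have b2 := log_sqrt_bound hn' hN
  have b3 := log_sqrt_bound hN hn'
  rw [abs_sub_comm] at b3
  set d := |√(n:ℝ) - √N| with hd
  have hd0 : 0 ≤ d := abs_nonneg _
  have hl : Real.log (1 + d) ≤ d := by
    have := Real.log_le_sub_one_of_pos (show 0 < 1 + d by linarith)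
    linarith
  have c1 : p * (Real.log n - Real.log N) ≤ 2 * |p| * Real.log (1 + d) := by
    calc p * (Real.log n - Real.log N) ≤ |p * (Real.log n - Real.log N)| := le_abs_self _
      _ = |p| * |Real.log n - Real.log N| := abs_mul _ _
      _ ≤ |p| * (2 * Real.log (1 + d)) := by
        apply mul_le_mul_of_nonneg_left _ (abs_nonneg p)
        rw [abs_le]; constructor <;> linarith
      _ = _ := by ring
  have c2 : -κ * d ^ 2 + m * d ≤ m ^ 2 / (4 * κ) := by
    rw [le_div_iff₀ (by positivity)]
    nlinarith [sq_nonneg (2 * κ * d - m)]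
  have c3 : -κ * (N - (n : ℝ) + (n : ℝ) * (Real.log n - Real.log N)) ≤ -κ * d ^ 2 := by nlinarith
  have hm0 : 0 ≤ m := by positivity
  have c4 : m * Real.log (1 + d) ≤ m * d := mul_le_mul_of_nonneg_left hl hm0
  have c5 : m * Real.log (1 + d) = 2 * |p| * Real.log (1 + d) + 4 * Real.log (1 + d) := by
    rw [hm]; ring
  calc _ ≤ Real.exp (m ^ 2 / (4 * κ) + -(4 * Real.log (1 + d))) := by
        apply Real.exp_le_exp.2; linarith
    _ = Real.exp (m ^ 2 / (4 * κ)) * ((1 + d) ^ 4)⁻¹ := by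
        rw [Real.exp_add, Real.exp_neg]
        congr 2
        rw [show (4:ℝ) * Real.log (1 + d) = Real.log (1 + d) * (4:ℕ) by push_cast; ring, Real.exp_mul,
          Real.exp_log (by linarith), Real.rpow_natCast]
    _ ≤ Real.exp (m ^ 2 / (4 * κ)) * (2 * (1 + y ^ 2)⁻¹) := by
        apply mul_le_mul_of_nonneg_left _ (Real.exp_pos _).le
        rw [← div_eq_mul_inv, inv_eq_one_div, div_le_div_iff₀ (by positivity) (by positivity)]
        have q1 : y ^ 2 ≤ ((1 + d) ^ 2) ^ 2 := by
          rw [← sq_abs y]; gcongr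
        have q2 : 1 ≤ (1 + d) ^ 4 := one_le_pow₀ (by linarith)
        nlinarith
    _ = _ := by ring

lemma tendsto_floor_w (y : ℝ) :
    Tendsto (fun N : ℝ => ((⌊N + √N * y⌋₊ : ℝ) - N) / √N) atTop (𝓝 y) := by
  have hs : Tendsto (fun N : ℝ => √N) atTop atTop := Real.tendsto_sqrt_atTop
  have h1 : Tendsto (fun N : ℝ => y - 1 / √N) atTop (𝓝 y) := by
    simpa using (hs.const_div_atTop 1).const_sub y
  refine tendsto_of_tendsto_of_tendsto_of_le_of_le' h1 tendsto_const_nhds ?_ ?_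
  all_goals
    filter_upwards [hs.eventually_ge_atTop (|y|), hs.eventually_ge_atTop 1] with N hN hN1
    have qN : √N ^ 2 = N := Real.sq_sqrt (by
      by_contra hc
      rw [Real.sqrt_eq_zero_of_nonpos (by linarith)] at hN1
      linarith)
    have hpos : 0 ≤ N + √N * y := by
      nlinarith [neg_abs_le y]
    have f1 := Nat.floor_le hpos
    have f2 := Nat.lt_floor_add_one (N + √N * y)
  · rw [le_div_iff₀ (by linarith)]
    have : (y - 1 / √N) * √N = √N * y - 1 := by
      have : √N ≠ 0 := by linarith
      field_simp
    linarith
  · rw [div_le_iff₀ (by linarith)]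
    linarith

lemma tendsto_psi (y : ℝ) :
    Tendsto (fun N : ℝ => N - (⌊N + √N * y⌋₊ : ℝ) + (⌊N + √N * y⌋₊ : ℝ) *
      (Real.log (⌊N + √N * y⌋₊ : ℝ) - Real.log N)) atTop (𝓝 (y ^ 2 / 2)) ∧
    Tendsto (fun N : ℝ => Real.log (⌊N + √N * y⌋₊ : ℝ) - Real.log N) atTop (𝓝 0) ∧
    Tendsto (fun N : ℝ => ⌊N + √N * y⌋₊) atTop atTop := by
  have hw := tendsto_floor_w y
  set w : ℝ → ℝ := fun N : ℝ => ((⌊N + √N * y⌋₊ : ℝ) - N) / √N with hwdef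
  have hs : Tendsto (fun N : ℝ => √N) atTop atTop := Real.tendsto_sqrt_atTop
  have hδ : Tendsto (fun N : ℝ => w N / √N) atTop (𝓝 0) := hw.div_atTop hs
  have hn : ∀ N : ℝ, 0 < N → (⌊N + √N * y⌋₊ : ℝ) = N * (1 + w N / √N) := by
    intro N hN
    have : √N ≠ 0 := (Real.sqrt_pos.2 hN).ne'
    have qN : √N ^ 2 = N := Real.sq_sqrt hN.le
    have e : w N / √N = ((⌊N + √N * y⌋₊ : ℝ) - N) / N := by
      rw [hwdef]; simp only; rw [div_div, ← sq, qN]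
    rw [e]; field_simp; ring
  have hsm : ∀ᶠ N : ℝ in atTop, |w N / √N| < 1/2 := by
    have := hδ.abs
    simp only [abs_zero] at this
    exact this.eventually_lt_const (by norm_num)
  have hlog : ∀ᶠ N : ℝ in atTop, Real.log (⌊N + √N * y⌋₊ : ℝ) - Real.log N
      = Real.log (1 + w N / √N) := by
    filter_upwards [hsm, eventually_gt_atTop 0] with N h1 h2
    have := (abs_lt.1 h1).1
    rw [hn N h2, Real.log_mul h2.ne' (by linarith)]; ring
  have hL : Tendsto (fun N : ℝ => Real.log (1 + w N / √N)) atTop (𝓝 0) := by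
    have := (hδ.const_add 1).log (by norm_num)
    simpa using this
  refine ⟨?_, hL.congr' (hlog.mono fun N h => h.symm), ?_⟩
  · set ρ : ℝ → ℝ := fun N => Real.log (1 + w N / √N) - w N / √N + (w N / √N) ^ 2 / 2 with hρ
    have hρ0 : Tendsto (fun N => N * ρ N) atTop (𝓝 0) := by
      have hb : Tendsto (fun N => 2 * (w N ^ 2 * |w N / √N|)) atTop (𝓝 0) := by
        have := ((hw.pow 2).mul hδ.abs).const_mul 2
        simpa using this
      refine squeeze_zero_norm' ?_ hb
      filter_upwards [hsm, eventually_gt_atTop 0] with N h1 h2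
      have h3 := Real.abs_log_sub_add_sum_range_le (x := -(w N / √N)) (by rw [abs_neg]; linarith) 2
      simp only [Finset.sum_range_succ, Finset.sum_range_zero, abs_neg] at h3
      have h4 : |ρ N| ≤ |w N / √N| ^ 3 / (1 - |w N / √N|) := by
        refine le_trans (le_of_eq ?_) h3
        congr 1
        rw [hρ]; push_cast; simp only [sub_neg_eq_add]; ring
      have h5 : |w N / √N| ^ 3 / (1 - |w N / √N|) ≤ 2 * |w N / √N| ^ 3 := by
        rw [div_le_iff₀ (by linarith)]
        have : 0 ≤ |w N / √N| ^ 3 := by positivity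
        nlinarith
      have qN : √N ^ 2 = N := Real.sq_sqrt h2.le
      have h6 : N * (w N / √N) ^ 2 = w N ^ 2 := by
        rw [div_pow, qN]; field_simp
      rw [Real.norm_eq_abs, abs_mul, abs_of_pos h2]
      calc N * |ρ N| ≤ N * (2 * |w N / √N| ^ 3) := by gcongr; linarith
        _ = 2 * ((N * |w N / √N| ^ 2) * |w N / √N|) := by ring
        _ = _ := by rw [sq_abs, h6]
    have hlim : Tendsto (fun N => w N ^ 2 / 2 - w N ^ 2 * (w N / √N) / 2 + (1 + w N / √N) * (N * ρ N))
        atTop (𝓝 (y ^ 2 / 2)) := by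
      have := (((hw.pow 2).div_const 2).sub (((hw.pow 2).mul hδ).div_const 2)).add
        ((hδ.const_add 1).mul hρ0)
      simpa using this
    refine hlim.congr' ?_
    filter_upwards [hlog, eventually_gt_atTop 0] with N h1 h2
    rw [h1, hn N h2]
    have qN : √N ^ 2 = N := Real.sq_sqrt h2.le
    have h6 : N * (w N / √N) ^ 2 = w N ^ 2 := by
      rw [div_pow, qN]; field_simp
    rw [← h6, hρ]
    ring
  · refine tendsto_nat_floor_atTop.comp ?_
    have : Tendsto (fun N : ℝ => √N * (√N + y)) atTop atTop :=
      hs.atTop_mul_atTop₀ (tendsto_atTop_add_const_right _ y hs)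
    refine this.congr' ?_
    filter_upwards [eventually_gt_atTop 0] with N h2
    have qN : √N ^ 2 = N := Real.sq_sqrt h2.le
    nlinarith

lemma laplace_sum (κ p R : ℝ) (hκ : 0 < κ) (r : ℕ → ℝ) (hr : Tendsto r atTop (𝓝 R))
    (hr0 : r 0 = 0) :
    (∀ N : ℝ, 1 ≤ N → Summable (fun n : ℕ => r n * Real.exp (-κ * (N - (n : ℝ) + (n : ℝ) *
      (Real.log n - Real.log N)) + p * (Real.log n - Real.log N)))) ∧
    Tendsto (fun N : ℝ => (√N)⁻¹ * ∑' n : ℕ, r n * Real.exp (-κ * (N - (n : ℝ) + (n : ℝ) *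
      (Real.log n - Real.log N)) + p * (Real.log n - Real.log N))) atTop
      (𝓝 (R * √(2 * Real.pi / κ))) := by
  obtain ⟨C, hC0, hC⟩ := exp_dom_bound κ p hκ
  obtain ⟨B, hB⟩ : ∃ B, ∀ n, |r n| ≤ B := by
    obtain ⟨B, hB⟩ := hr.abs.bddAbove_range
    exact ⟨B, fun n => hB ⟨n, rfl⟩⟩
  have hB0 : 0 ≤ B := le_trans (abs_nonneg _) (hB 0)
  set G : ℝ → ℕ → ℝ := fun N n => r n * Real.exp (-κ * (N - (n : ℝ) + (n : ℝ) *
      (Real.log n - Real.log N)) + p * (Real.log n - Real.log N)) with hG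
  have hdom : ∀ N y : ℝ, 1 ≤ N → ‖G N ⌊N + √N * y⌋₊‖ ≤ B * C * (1 + y ^ 2)⁻¹ := by
    intro N y hN
    rcases Nat.eq_zero_or_pos ⌊N + √N * y⌋₊ with h | h
    · rw [h, hG]; simp only [hr0, zero_mul, norm_zero]; positivity
    · rw [hG]; simp only
      rw [Real.norm_eq_abs, abs_mul, abs_of_pos (Real.exp_pos _), mul_assoc]
      exact mul_le_mul (hB _) (hC N y hN h) (Real.exp_pos _).le hB0
  have hmeas : ∀ N : ℝ, Measurable (fun y : ℝ => G N ⌊N + √N * y⌋₊) := by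
    intro N
    have h1 : Measurable (G N) := measurable_from_nat
    exact h1.comp (Nat.measurable_floor.comp (by fun_prop))
  have hbi : MeasureTheory.Integrable (fun y : ℝ => B * C * (1 + y ^ 2)⁻¹) :=
    integrable_inv_one_add_sq.const_mul _
  have hint : ∀ N : ℝ, 1 ≤ N → MeasureTheory.Integrable (fun y : ℝ => G N ⌊N + √N * y⌋₊) := by
    intro N hN
    exact hbi.mono' (hmeas N).aestronglyMeasurable (Filter.Eventually.of_forall fun y => hdom N y hN)
  have hint2 : ∀ N : ℝ, 1 ≤ N → MeasureTheory.Integrable (fun s : ℝ => G N ⌊s⌋₊) := by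
    intro N hN
    have hs : √N ≠ 0 := by have := Real.one_le_sqrt.2 hN; linarith
    have h1 := hint N hN
    have h2 := (MeasureTheory.integrable_comp_mul_left_iff (fun s : ℝ => G N ⌊N + s⌋₊) hs).1 h1
    have h3 := h2.comp_add_left (-N)
    simpa using h3
  have hsum : ∀ N : ℝ, 1 ≤ N → HasSum (G N) (∫ s : ℝ, G N ⌊s⌋₊) := fun N hN =>
    hasSum_of_integrable_floor (G N) (by simp [hG, hr0]) (hint2 N hN)
  refine ⟨fun N hN => (hsum N hN).summable, ?_⟩
  have hchange : ∀ N : ℝ, 1 ≤ N → (√N)⁻¹ * ∑' n, G N n = ∫ y : ℝ, G N ⌊N + √N * y⌋₊ := by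
    intro N hN
    have hs : 0 < √N := by have := Real.one_le_sqrt.2 hN; linarith
    rw [(hsum N hN).tsum_eq]
    have h1 := MeasureTheory.Measure.integral_comp_mul_left (fun s : ℝ => G N ⌊N + s⌋₊) (√N)
    rw [h1, MeasureTheory.integral_add_left_eq_self (fun s : ℝ => G N ⌊s⌋₊) N,
      abs_of_pos (inv_pos.2 hs), smul_eq_mul]
  have hlim : Tendsto (fun N : ℝ => ∫ y : ℝ, G N ⌊N + √N * y⌋₊) atTop
      (𝓝 (∫ y : ℝ, R * Real.exp (-(κ / 2) * y ^ 2))) := by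
    refine MeasureTheory.tendsto_integral_filter_of_dominated_convergence
      (fun y : ℝ => B * C * (1 + y ^ 2)⁻¹)
      (Filter.Eventually.of_forall fun N => (hmeas N).aestronglyMeasurable) ?_ hbi ?_
    · filter_upwards [eventually_ge_atTop 1] with N hN
      exact Filter.Eventually.of_forall fun y => hdom N y hN
    · refine Filter.Eventually.of_forall fun y => ?_
      obtain ⟨t1, t2, t3⟩ := tendsto_psi y
      have h1 := (hr.comp t3).mul ((Real.continuous_exp.tendsto _).comp
        ((t1.const_mul (-κ)).add (t2.const_mul p)))
      have e : -κ * (y ^ 2 / 2) + p * 0 = -(κ / 2) * y ^ 2 := by ring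
      rw [e] at h1
      exact h1
  rw [MeasureTheory.integral_const_mul, integral_gaussian] at hlim
  have e : Real.pi / (κ / 2) = 2 * Real.pi / κ := by field_simp
  rw [e] at hlim
  refine hlim.congr' ?_
  filter_upwards [eventually_ge_atTop 1] with N hN
  exact (hchange N hN).symm

lemma struve_coeff_tendsto (ν a : ℝ) (ha : 0 < a) :
    Tendsto (fun n : ℕ => (Real.Gamma (n + 3/2) * Real.Gamma (a * n + ν + 3/2))⁻¹ *
      Real.exp (((1 + a) * n + ν + 2) * Real.log n + a * n * Real.log a - (1 + a) * n)) atTop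
      (𝓝 (Real.exp (-Real.log (2 * Real.pi) - (ν + 1) * Real.log a))) := by
  have hc : Tendsto (fun n : ℕ => (n : ℝ)) atTop atTop := tendsto_natCast_atTop_atTop
  have h1 := (gamma_log_stirling_shift (3/2)).comp hc
  have hac : Tendsto (fun n : ℕ => a * (n : ℝ)) atTop atTop := hc.const_mul_atTop ha
  have h2 := (gamma_log_stirling_shift (ν + 3/2)).comp hac
  have h3 := (Real.continuous_exp.tendsto _).comp ((h1.neg.sub h2).sub_const ((ν + 1) * Real.log a))
  have e : -(Real.log (2 * Real.pi) / 2) - Real.log (2 * Real.pi) / 2 - (ν + 1) * Real.log a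
      = -Real.log (2 * Real.pi) - (ν + 1) * Real.log a := by ring
  rw [e] at h3
  refine h3.congr' ?_
  filter_upwards [hc.eventually_gt_atTop 0, hac.eventually_gt_atTop (-(ν + 3/2))] with n hn hn2
  have g1 : 0 < Real.Gamma ((n:ℝ) + 3/2) := Real.Gamma_pos_of_pos (by linarith)
  have g2 : 0 < Real.Gamma (a * n + (ν + 3/2)) := Real.Gamma_pos_of_pos (by linarith)
  simp only [Function.comp]
  rw [show a * (n:ℝ) + ν + 3/2 = a * n + (ν + 3/2) by ring]
  rw [Real.log_mul ha.ne' hn.ne']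
  rw [← Real.exp_log (inv_pos.2 (mul_pos g1 g2)), Real.log_inv, Real.log_mul g1.ne' g2.ne', ← Real.exp_add]
  congr 1
  ring

lemma struve_const (ν a : ℝ) (ha : 0 < a) :
    (1 + a) ^ (ν + 3/2) * (Real.exp (-Real.log (2 * Real.pi) - (ν + 1) * Real.log a) *
      √(2 * Real.pi / (1 + a))) = ((1 + a) / a) ^ (ν + 1) / √(2 * Real.pi) := by
  have hκ : 0 < 1 + a := by linarith
  have hp : 0 < 2 * Real.pi := by positivity
  have h2 : √(2 * Real.pi) = Real.exp (Real.log (2 * Real.pi) / 2) := by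
    rw [← Real.log_sqrt hp.le, Real.exp_log (Real.sqrt_pos.2 hp)]
  have h1 : √(2 * Real.pi / (1 + a)) = Real.exp (Real.log (2 * Real.pi) / 2 - Real.log (1 + a) / 2) := by
    rw [← sub_div, ← Real.log_div hp.ne' hκ.ne', ← Real.log_sqrt (by positivity),
      Real.exp_log (Real.sqrt_pos.2 (by positivity))]
  rw [h1, h2, Real.rpow_def_of_pos hκ, Real.rpow_def_of_pos (by positivity),
    Real.log_div hκ.ne' ha.ne', ← Real.exp_add, ← Real.exp_add, ← Real.exp_sub]
  congr 1
  ring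

lemma struve_real (ν a : ℝ) (ha : 0 < a) :
    Tendsto (fun x : ℝ => (∑' n : ℕ, (x / 2) ^ (2 * n) *
        (Real.Gamma (n + 3/2) * Real.Gamma (a * n + ν + 3/2))⁻¹) *
        struveZ a x ^ (ν + 3/2) * Real.exp (-struveZ a x)) atTop
      (𝓝 (((1 + a) / a) ^ (ν + 1) / √(2 * Real.pi))) := by
  have hκ : 0 < 1 + a := by linarith
  set c : ℕ → ℝ := fun n => (Real.Gamma (n + 3/2) * Real.Gamma (a * n + ν + 3/2))⁻¹ with hcdef
  set R := Real.exp (-Real.log (2 * Real.pi) - (ν + 1) * Real.log a) with hR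
  set r : ℕ → ℝ := fun n => if n = 0 then 0 else c n *
    Real.exp (((1 + a) * n + ν + 2) * Real.log n + a * n * Real.log a - (1 + a) * n) with hrdef
  have hr : Tendsto r atTop (𝓝 R) := by
    refine (struve_coeff_tendsto ν a ha).congr' ?_
    filter_upwards [eventually_ne_atTop 0] with n hn
    simp [hrdef, hn, hcdef]
  obtain ⟨hS, hT⟩ := laplace_sum (1 + a) (-(ν + 2)) R hκ r hr (by simp [hrdef])
  set G : ℝ → ℕ → ℝ := fun N n => r n * Real.exp (-(1 + a) * (N - (n : ℝ) + (n : ℝ) *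
      (Real.log n - Real.log N)) + -(ν + 2) * (Real.log n - Real.log N)) with hG
  set M : ℝ → ℝ := fun x => (a ^ (-a) * x ^ 2 / 4) ^ (1 / (1 + a)) with hM
  have hMt : Tendsto M atTop atTop := by
    refine (tendsto_rpow_atTop (by positivity : 0 < 1 / (1 + a))).comp ?_
    have : 0 < a ^ (-a) := by positivity
    have h1 : Tendsto (fun x : ℝ => x ^ 2) atTop atTop := tendsto_pow_atTop (by norm_num)
    exact (h1.const_mul_atTop this).atTop_div_const (by norm_num)
  have hmain : Tendsto (fun N : ℝ => (1 + a) ^ (ν + 3/2) *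
      (c 0 * (N ^ (ν + 3/2) * Real.exp (-(1 + a) * N)) + (√N)⁻¹ * ∑' n, G N n)) atTop
      (𝓝 (((1 + a) / a) ^ (ν + 1) / √(2 * Real.pi))) := by
    rw [← struve_const ν a ha]
    have h0 := (tendsto_rpow_mul_exp_neg_mul_atTop_nhds_zero (ν + 3/2) (1 + a) hκ).const_mul (c 0)
    have := (h0.add hT).const_mul ((1 + a) ^ (ν + 3/2))
    rwa [mul_zero, zero_add] at this
  refine (hmain.comp hMt).congr' ?_
  filter_upwards [eventually_gt_atTop 0, hMt.eventually_ge_atTop 1] with x hx hN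
  have hZ : struveZ a x = (1 + a) * M x := rfl
  have hN0 : 0 < M x := by linarith
  have hlog : (1 + a) * Real.log (M x) + a * Real.log a = 2 * Real.log (x / 2) := by
    have h1 : 0 < a ^ (-a) := by positivity
    have e : a ^ (-a) * x ^ 2 / 4 = a ^ (-a) * (x / 2) ^ 2 := by ring
    rw [hM]; simp only
    rw [e, Real.log_rpow (by positivity), Real.log_mul h1.ne' (by positivity), Real.log_rpow ha,
      Real.log_pow]
    field_simp
    push_cast
    ring
  simp only [Function.comp]
  rw [hZ]
  generalize M x = N at *
  have hterm : ∀ n : ℕ, (x / 2) ^ (2 * n) * c n = (if n = 0 then c 0 else 0) +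
      Real.exp ((1 + a) * N - (ν + 2) * Real.log N) * G N n := by
    intro n
    rcases eq_or_ne n 0 with rfl | hn
    · simp [hG, hrdef]
    · have hxp : (x / 2) ^ (2 * n) = Real.exp (n * ((1 + a) * Real.log N + a * Real.log a)) := by
        rw [hlog, ← Real.rpow_natCast, Real.rpow_def_of_pos (by positivity)]
        congr 1; push_cast; ring
      rw [hxp]
      simp only [hG, hrdef, hn, if_false, zero_add]
      rw [mul_assoc (c n), ← Real.exp_add, mul_left_comm, ← Real.exp_add, mul_comm]
      congr 2
      ring
  have hsum : ∑' n : ℕ, (x / 2) ^ (2 * n) * c n =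
      c 0 + Real.exp ((1 + a) * N - (ν + 2) * Real.log N) * ∑' n, G N n := by
    have h1 : HasSum (fun n : ℕ => if n = 0 then c 0 else 0) (c 0) := hasSum_ite_eq 0 (c 0)
    have h2 := h1.add ((hS N hN).hasSum.mul_left (Real.exp ((1 + a) * N - (ν + 2) * Real.log N)))
    rw [tsum_congr hterm]
    exact h2.tsum_eq
  rw [hsum, Real.mul_rpow hκ.le hN0.le]
  have hsq : (√N)⁻¹ = N ^ (ν + 3/2) * Real.exp (-((1 + a) * N)) *
      Real.exp ((1 + a) * N - (ν + 2) * Real.log N) := by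
    rw [Real.rpow_def_of_pos hN0, ← Real.exp_add, ← Real.exp_add,
      ← Real.exp_log (Real.sqrt_pos.2 hN0), ← Real.exp_neg, Real.log_sqrt hN0.le]
    congr 1; ring
  rw [hsq, neg_mul]
  ring

/-- Leading exponential asymptotics of `L_ν(x;a)` for `a > 0` as `x → +∞`:
`(x/2)^{−ν−1} L_ν(x;a) · Z^{ν+3/2} e^{−Z} → A₀ = (κ/a)^{ν+1}/√(2π)`. -/
theorem struveL_exponential_asymptotics (ν a : ℝ) (ha : 0 < a) :
    Tendsto (fun x : ℝ =>
      ((x : ℂ) / 2) ^ (-(ν : ℂ) - 1) * struveL ν a (x : ℂ) *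
        ((struveZ a x ^ (ν + 3 / 2) : ℝ) : ℂ) * (Real.exp (-struveZ a x) : ℂ))
      atTop
      (𝓝 (((((1 + a) / a) ^ (ν + 1) / Real.sqrt (2 * Real.pi) : ℝ)) : ℂ)) := by
  refine ((Complex.continuous_ofReal.tendsto _).comp (struve_real ν a ha)).congr' ?_
  filter_upwards [eventually_gt_atTop 0] with x hx
  have hx2 : (x : ℂ) / 2 ≠ 0 := by
    have : (x : ℂ) ≠ 0 := by exact_mod_cast hx.ne'
    simpa using this
  have hc : ((x : ℂ) / 2) ^ (-(ν : ℂ) - 1) * ((x : ℂ) / 2) ^ ((ν : ℂ) + 1) = 1 := by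
    rw [← Complex.cpow_add _ _ hx2]
    simp
  unfold struveL
  rw [← mul_assoc, hc, one_mul]
  simp only [Function.comp]
  rw [Complex.ofReal_mul, Complex.ofReal_mul, Complex.ofReal_tsum]
  congr 2
  refine tsum_congr fun n => ?_
  have g1 : Complex.Gamma ((n : ℂ) + 3 / 2) = ((Real.Gamma ((n : ℝ) + 3 / 2) : ℝ) : ℂ) := by
    rw [← Complex.Gamma_ofReal]; push_cast; rfl
  have g2 : Complex.Gamma ((a : ℂ) * (n : ℂ) + (ν : ℂ) + 3 / 2)
      = ((Real.Gamma (a * (n : ℝ) + ν + 3 / 2) : ℝ) : ℂ) := by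
    rw [← Complex.Gamma_ofReal]; push_cast; rfl
  rw [g1, g2, div_eq_mul_inv]
  push_cast
  rfl
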